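/- Continuity of the log-optimal value and returns under weak convergence: let K = {u ∈ ℝ^m : u_i ≥ 0 for all i, ⟨b̂, u⟩ = 1} (the closure of 𝒰, a compact set), and for a probability measure Q on K let V(Q) = sup_{b ∈ Δ} ∫ log⟨b, u⟩ dQ(u) ∈ [0, log m] and let b*(Q) denote any maximizer. If probability measures Q_n on K converge weakly to Q_∞, then V(Q_n) → V(Q_∞), and for any choices of maximizers, ⟨b*(Q_n), u⟩ → ⟨b*(Q_∞), u⟩ for Q_∞-almost every u. (Paper's Lemma 4(b).) -/

import Mathlib

open MeasureTheory Filter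
open scoped BigOperators ENNReal Topology

/-- Inner product of two vectors in `ℝ^m`. -/
noncomputable def ip {m : ℕ} (b x : Fin m → ℝ) : ℝ := ∑ i, b i * x i

/-- The closed portfolio simplex. -/
def simplex (m : ℕ) : Set (Fin m → ℝ) := {b | (∀ i, 0 ≤ b i) ∧ ∑ i, b i = 1}

/-- The uniform reference portfolio `b̂ = (1/m, …, 1/m)`. -/
noncomputable def bhat (m : ℕ) : Fin m → ℝ := fun _ => (m : ℝ)⁻¹

/-- `K`, the closure of `𝒰`: nonnegative vectors with `⟨b̂, u⟩ = 1`. -/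
def Kset (m : ℕ) : Set (Fin m → ℝ) := {u | (∀ i, 0 ≤ u i) ∧ ip (bhat m) u = 1}

/-- `nlog m r` is the nonnegative extended-real value `log m − log r`, set to `∞` for `r ≤ 0`. -/
noncomputable def nlog (m : ℕ) (r : ℝ) : ℝ≥0∞ :=
  if r ≤ 0 then ⊤ else ENNReal.ofReal (Real.log m - Real.log r)

/-- `∫ log⟨b, u⟩ dQ(u) ∈ [−∞, log m]` for a measure `Q` supported on `K`. -/
noncomputable def elogQ {m : ℕ} (Q : Measure (Fin m → ℝ)) (b : Fin m → ℝ) : EReal :=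
  (Real.log m : EReal) - ((∫⁻ u, nlog m (ip b u) ∂Q : ℝ≥0∞) : EReal)

section Nlog

lemma nlog_of_pos {m : ℕ} {r : ℝ} (hr : 0 < r) :
    nlog m r = ENNReal.ofReal (Real.log m - Real.log r) := by
  simp [nlog, not_le.mpr hr]

lemma nlog_of_nonpos {m : ℕ} {r : ℝ} (hr : r ≤ 0) : nlog m r = ⊤ := by
  simp [nlog, hr]

lemma nlog_antitone (m : ℕ) : Antitone (nlog m) := by
  intro r s hrs
  rcases le_or_gt r 0 with hr | hr
  · simp [nlog_of_nonpos hr]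
  · rw [nlog_of_pos hr, nlog_of_pos (hr.trans_le hrs)]
    gcongr

lemma nlog_continuous (m : ℕ) : Continuous (nlog m) := by
  rw [continuous_iff_continuousAt]
  intro r
  rcases lt_trichotomy r 0 with hr | rfl | hr
  · have h : nlog m =ᶠ[𝓝 r] fun _ => ⊤ := by
      filter_upwards [gt_mem_nhds hr] with s hs using nlog_of_nonpos hs.le
    exact continuousAt_const.congr h.symm
  · have hpos : Tendsto (nlog m) (𝓝[>] 0) (𝓝 ⊤) := by
      have h : Tendsto (fun s => ENNReal.ofReal (Real.log m - Real.log s)) (𝓝[>] 0) (𝓝 ⊤) := by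
        refine ENNReal.tendsto_ofReal_atTop.comp ?_
        simp only [sub_eq_add_neg]
        exact tendsto_atTop_add_const_left _ _
          (tendsto_neg_atBot_atTop.comp Real.tendsto_log_nhdsGT_zero)
      refine h.congr' ?_
      filter_upwards [self_mem_nhdsWithin] with s hs using (nlog_of_pos hs).symm
    have hneg : Tendsto (nlog m) (𝓝[≤] 0) (𝓝 ⊤) := by
      refine tendsto_const_nhds.congr' ?_
      filter_upwards [self_mem_nhdsWithin] with s hs using (nlog_of_nonpos hs).symm
    rw [ContinuousAt, nlog_of_nonpos le_rfl, ← nhdsLE_sup_nhdsGT]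
    exact hneg.sup hpos
  · have h : nlog m =ᶠ[𝓝 r] fun s => ENNReal.ofReal (Real.log m - Real.log s) := by
      filter_upwards [lt_mem_nhds hr] with s hs using nlog_of_pos hs
    refine ContinuousAt.congr ?_ h.symm
    exact ENNReal.continuous_ofReal.continuousAt.comp
      (continuousAt_const.sub (Real.continuousAt_log hr.ne'))

lemma nlog_mul_le {m : ℕ} {a : ℝ} (ha : 0 < a) (r : ℝ) :
    nlog m (a * r) ≤ nlog m r + ENNReal.ofReal (-Real.log a) := by
  rcases le_or_gt r 0 with hr | hr
  · simp [nlog_of_nonpos hr]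
  · rw [nlog_of_pos hr, nlog_of_pos (mul_pos ha hr), Real.log_mul ha.ne' hr.ne']
    refine le_trans (ENNReal.ofReal_le_ofReal ?_) ENNReal.ofReal_add_le
    linarith

lemma two_log_midpoint {x y : ℝ} (hx : 0 < x) (hy : 0 < y) :
    Real.log x + Real.log y ≤ 2 * Real.log ((x + y) / 2) := by
  rw [← Real.log_mul hx.ne' hy.ne', ← Nat.cast_two, ← Real.log_pow]
  refine Real.log_le_log (mul_pos hx hy) ?_
  norm_num
  nlinarith [sq_nonneg (x - y)]

lemma eq_of_two_log_midpoint {x y : ℝ} (hx : 0 < x) (hy : 0 < y)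
    (h : 2 * Real.log ((x + y) / 2) = Real.log x + Real.log y) : x = y := by
  rw [← Real.log_mul hx.ne' hy.ne', ← Nat.cast_two, ← Real.log_pow] at h
  have h2 := Real.log_injOn_pos (Set.mem_Ioi.mpr (by positivity))
    (Set.mem_Ioi.mpr (mul_pos hx hy)) h
  have : (x - y) ^ 2 = 0 := by linear_combination 4 * h2
  exact sub_eq_zero.mp (pow_eq_zero_iff two_ne_zero |>.mp this)

/-- The value `nlog` is midpoint convex below the level `m`. -/
lemma two_nlog_midpoint_le {m : ℕ} {x y : ℝ} (hxm : x ≤ m) (hym : y ≤ m) :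
    2 * nlog m ((x + y) / 2) ≤ nlog m x + nlog m y := by
  rcases le_or_gt x 0 with hx | hx
  · simp [nlog_of_nonpos hx]
  rcases le_or_gt y 0 with hy | hy
  · simp [nlog_of_nonpos hy]
  have lx := Real.log_le_log hx hxm
  have ly := Real.log_le_log hy hym
  rw [nlog_of_pos hx, nlog_of_pos hy, nlog_of_pos (by positivity),
    ← ENNReal.ofReal_add (by linarith) (by linarith), ← ENNReal.ofReal_ofNat 2,
    ← ENNReal.ofReal_mul (by norm_num)]
  refine ENNReal.ofReal_le_ofReal ?_
  linarith [two_log_midpoint hx hy]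

/-- Equality in midpoint convexity of `nlog`, at finite values, forces equality of the points. -/
lemma eq_of_two_nlog_midpoint {m : ℕ} {x y : ℝ} (hxm : x ≤ m) (hym : y ≤ m)
    (hx : nlog m x ≠ ⊤) (hy : nlog m y ≠ ⊤)
    (h : 2 * nlog m ((x + y) / 2) = nlog m x + nlog m y) : x = y := by
  have hx0 : 0 < x := not_le.mp fun h => hx (nlog_of_nonpos h)
  have hy0 : 0 < y := not_le.mp fun h => hy (nlog_of_nonpos h)
  have lx := Real.log_le_log hx0 hxm
  have ly := Real.log_le_log hy0 hym
  have lz := Real.log_le_log (show 0 < (x + y) / 2 by positivity) (by linarith : _ ≤ (m : ℝ))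
  rw [nlog_of_pos hx0, nlog_of_pos hy0, nlog_of_pos (by positivity),
    ← ENNReal.ofReal_add (by linarith) (by linarith), ← ENNReal.ofReal_ofNat 2,
    ← ENNReal.ofReal_mul (by norm_num),
    ENNReal.ofReal_eq_ofReal_iff (by linarith) (by linarith)] at h
  exact eq_of_two_log_midpoint hx0 hy0 (by linarith)

end Nlog

section Geometry

variable {m : ℕ}

lemma ip_add_left (a b u : Fin m → ℝ) : ip (a + b) u = ip a u + ip b u := by
  simp [ip, add_mul, Finset.sum_add_distrib]

lemma ip_smul_left (c : ℝ) (b u : Fin m → ℝ) : ip (c • b) u = c * ip b u := by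
  simp [ip, Finset.mul_sum, mul_assoc]

lemma continuous_ip_right (b : Fin m → ℝ) : Continuous (ip b) := by
  unfold ip; fun_prop

lemma continuous_ip_left (u : Fin m → ℝ) : Continuous fun b => ip b u := by
  unfold ip; fun_prop

lemma measurable_nlog_ip (b : Fin m → ℝ) : Measurable fun u => nlog m (ip b u) :=
  ((nlog_continuous m).comp (continuous_ip_right b)).measurable

lemma bhat_mem_simplex (hm : m ≠ 0) : bhat m ∈ simplex m :=
  ⟨fun _ => by simp [bhat], by simp [bhat, hm]⟩

lemma convex_simplex (m : ℕ) : Convex ℝ (simplex m) := convex_stdSimplex ℝ (Fin m)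

lemma isCompact_simplex (m : ℕ) : IsCompact (simplex m) := isCompact_stdSimplex ℝ (Fin m)

lemma sum_eq_of_mem_Kset (hm : m ≠ 0) {u : Fin m → ℝ} (hu : u ∈ Kset m) : ∑ i, u i = m := by
  have h := hu.2
  have hm' : (m : ℝ) ≠ 0 := by exact_mod_cast hm
  rw [ip] at h
  simp only [bhat, ← Finset.mul_sum] at h
  field_simp at h
  exact h

lemma ip_nonneg {b u : Fin m → ℝ} (hb : b ∈ simplex m) (hu : u ∈ Kset m) : 0 ≤ ip b u :=
  Finset.sum_nonneg fun i _ => mul_nonneg (hb.1 i) (hu.1 i)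

lemma ip_le (hm : m ≠ 0) {b u : Fin m → ℝ} (hb : b ∈ simplex m) (hu : u ∈ Kset m) :
    ip b u ≤ m := by
  rw [← sum_eq_of_mem_Kset hm hu]
  refine Finset.sum_le_sum fun i _ => mul_le_of_le_one_left (hu.1 i) ?_
  rw [← hb.2]
  exact Finset.single_le_sum (fun j _ => hb.1 j) (Finset.mem_univ i)

lemma measurableSet_Kset (m : ℕ) : MeasurableSet (Kset m) := by
  have h : IsClosed (Kset m) := by
    have h1 : IsClosed {u : Fin m → ℝ | ∀ i, 0 ≤ u i} := by
      simp only [Set.ofPred_forall]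
      exact isClosed_iInter fun i => isClosed_le continuous_const (continuous_apply i)
    exact h1.inter (isClosed_eq (continuous_ip_right (bhat m)) continuous_const)
  exact h.measurableSet

lemma ae_mem_Kset {P : ProbabilityMeasure (Fin m → ℝ)}
    (hP : (P : Measure (Fin m → ℝ)) (Kset m) = 1) :
    ∀ᵐ u ∂(P : Measure (Fin m → ℝ)), u ∈ Kset m :=
  (mem_ae_iff_prob_eq_one (measurableSet_Kset m)).mpr hP

/-- The exceptional null sets of all the almost surely vanishing linear forms can be merged. -/
lemma ae_forall_ip_eq_zero (μ : Measure (Fin m → ℝ)) :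
    ∀ᵐ u ∂μ, ∀ v : Fin m → ℝ, (∀ᵐ w ∂μ, ip v w = 0) → ip v u = 0 := by
  let S : Submodule ℝ (Fin m → ℝ) :=
    { carrier := {v | ∀ᵐ w ∂μ, ip v w = 0}
      zero_mem' := by simp [ip]
      add_mem' := by
        intro a b ha hb
        rw [Set.mem_ofPred_eq] at *
        filter_upwards [ha, hb] with w h1 h2
        rw [ip_add_left, h1, h2, add_zero]
      smul_mem' := by
        intro c a ha
        rw [Set.mem_ofPred_eq] at *
        filter_upwards [ha] with w h1
        rw [ip_smul_left, h1, mul_zero] }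
  obtain ⟨s, hs⟩ : S.FG := IsNoetherian.noetherian S
  have h : ∀ᵐ u ∂μ, ∀ v ∈ s, ip v u = 0 := by
    rw [Finset.eventually_all]
    intro v hv
    have : v ∈ S := hs ▸ Submodule.subset_span hv
    exact this
  filter_upwards [h] with u hu v hv
  have hvS : v ∈ Submodule.span ℝ (s : Set (Fin m → ℝ)) := hs ▸ (show v ∈ S from hv)
  induction hvS using Submodule.span_induction with
  | mem x hx => exact hu x hx
  | zero => simp [ip]
  | add x y hx hy ihx ihy =>
    rw [ip_add_left, ihx (show x ∈ S from hs ▸ hx), ihy (show y ∈ S from hs ▸ hy), add_zero]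
  | smul c x hx ihx => rw [ip_smul_left, ihx (show x ∈ S from hs ▸ hx), mul_zero]

end Geometry

section Optimal

variable {m : ℕ}

/-- Weak convergence applied to truncated logarithmic losses. -/
lemma tendsto_lintegral_nlog_max {ι : Type*} {L : Filter ι}
    {P : ι → ProbabilityMeasure (Fin m → ℝ)} {R : ProbabilityMeasure (Fin m → ℝ)}
    (h : Tendsto P L (𝓝 R)) {f : (Fin m → ℝ) → ℝ} (hf : Continuous f) {ε : ℝ} (hε : 0 < ε) :
    Tendsto (fun n => ∫⁻ u, nlog m (max (f u) ε) ∂(P n : Measure (Fin m → ℝ))) L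
      (𝓝 (∫⁻ u, nlog m (max (f u) ε) ∂(R : Measure (Fin m → ℝ)))) := by
  have hpos : ∀ u, 0 < max (f u) ε := fun u => lt_max_of_lt_right hε
  let g : C(Fin m → ℝ, NNReal) :=
    ⟨fun u => Real.toNNReal (Real.log m - Real.log (max (f u) ε)),
      continuous_real_toNNReal.comp
        (continuous_const.sub ((hf.max continuous_const).log fun u => (hpos u).ne'))⟩
  let C : NNReal := Real.toNNReal (Real.log m - Real.log ε)
  have hg : ∀ u, (g u : ℝ) ∈ Set.Icc (0 : ℝ) C := fun u =>
    ⟨(g u).2, NNReal.coe_le_coe.mpr (Real.toNNReal_le_toNNReal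
      (sub_le_sub_left (Real.log_le_log hε (le_max_right _ _)) _))⟩
  let G : BoundedContinuousFunction (Fin m → ℝ) NNReal :=
    BoundedContinuousFunction.mkOfBound g (C - 0) fun x y =>
      Real.dist_le_of_mem_Icc (hg x) (hg y)
  have key := ProbabilityMeasure.tendsto_iff_forall_lintegral_tendsto.mp h G
  have hG : ∀ u, nlog m (max (f u) ε) = (G u : ℝ≥0∞) := fun u => nlog_of_pos (hpos u)
  simpa only [hG] using key

/-- Upper semicontinuity of the minimal logarithmic loss. -/
lemma eventually_lintegral_nlog_lt (hm : m ≠ 0) {ι : Type*} {L : Filter ι}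
    {P : ι → ProbabilityMeasure (Fin m → ℝ)} {R : ProbabilityMeasure (Fin m → ℝ)}
    (hP : ∀ n, (P n : Measure (Fin m → ℝ)) (Kset m) = 1)
    (hR : (R : Measure (Fin m → ℝ)) (Kset m) = 1)
    (h : Tendsto P L (𝓝 R)) {β : ι → Fin m → ℝ}
    (hβ : ∀ n, ∀ b ∈ simplex m, ∫⁻ u, nlog m (ip (β n) u) ∂(P n : Measure (Fin m → ℝ)) ≤
      ∫⁻ u, nlog m (ip b u) ∂(P n : Measure (Fin m → ℝ)))
    {b : Fin m → ℝ} (hb : b ∈ simplex m) {c : ℝ≥0∞}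
    (hc : ∫⁻ u, nlog m (ip b u) ∂(R : Measure (Fin m → ℝ)) < c) :
    ∀ᶠ n in L, ∫⁻ u, nlog m (ip (β n) u) ∂(P n : Measure (Fin m → ℝ)) < c := by
  set F := ∫⁻ u, nlog m (ip b u) ∂(R : Measure (Fin m → ℝ)) with hF
  have hlim : Tendsto (fun ε : ℝ => F + ENNReal.ofReal (-Real.log (1 - ε))) (𝓝[>] 0) (𝓝 F) := by
    have h1 : ContinuousAt (fun ε : ℝ => -Real.log (1 - ε)) 0 :=
      ((continuousAt_const.sub continuousAt_id).log (by simp)).neg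
    have h2 := (ENNReal.tendsto_ofReal (h1.tendsto.mono_left
      (nhdsWithin_le_nhds (s := Set.Ioi 0)))).const_add F
    simpa using h2
  obtain ⟨ε, hεc, hε0, hε1⟩ := ((hlim.eventually (gt_mem_nhds hc)).and
    (Ioo_mem_nhdsGT (zero_lt_one' ℝ))).exists
  set bε := (1 - ε) • b + ε • bhat m with hbε
  have hbεs : bε ∈ simplex m :=
    convex_simplex m hb (bhat_mem_simplex hm) (by linarith) hε0.le (by ring)
  have hip : ∀ u ∈ Kset m, ip bε u = (1 - ε) * ip b u + ε := by
    intro u hu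
    rw [hbε, ip_add_left, ip_smul_left, ip_smul_left, hu.2, mul_one]
  have hmax : ∀ u ∈ Kset m, max (ip bε u) ε = ip bε u := by
    intro u hu
    refine max_eq_left ?_
    rw [hip u hu]
    nlinarith [mul_nonneg (sub_nonneg.mpr hε1.le) (ip_nonneg hb hu)]
  have hlt : ∫⁻ u, nlog m (max (ip bε u) ε) ∂(R : Measure (Fin m → ℝ)) < c := by
    refine lt_of_le_of_lt ?_ hεc
    calc _ ≤ ∫⁻ u, (nlog m (ip b u) + ENNReal.ofReal (-Real.log (1 - ε)))
          ∂(R : Measure (Fin m → ℝ)) := by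
          refine lintegral_mono_ae ?_
          filter_upwards [ae_mem_Kset hR] with u hu
          rw [hmax u hu]
          refine le_trans (nlog_antitone m ?_) (nlog_mul_le (sub_pos.mpr hε1) _)
          rw [hip u hu]
          linarith
      _ = F + ENNReal.ofReal (-Real.log (1 - ε)) := by
          rw [lintegral_add_right _ measurable_const, lintegral_const, measure_univ, mul_one]
  filter_upwards [(tendsto_lintegral_nlog_max h (continuous_ip_right bε) hε0).eventually
    (gt_mem_nhds hlt)] with n hn
  refine lt_of_le_of_lt (hβ n bε hbεs) (lt_of_eq_of_lt (lintegral_congr_ae ?_) hn)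
  filter_upwards [ae_mem_Kset (hP n)] with u hu
  rw [hmax u hu]

/-- Joint lower semicontinuity of the logarithmic loss. -/
lemma eventually_lt_lintegral_nlog (hm : m ≠ 0) {ι : Type*} {L : Filter ι}
    {P : ι → ProbabilityMeasure (Fin m → ℝ)} {R : ProbabilityMeasure (Fin m → ℝ)}
    (hP : ∀ n, (P n : Measure (Fin m → ℝ)) (Kset m) = 1)
    (h : Tendsto P L (𝓝 R)) {β : ι → Fin m → ℝ} {b : Fin m → ℝ}
    (hβ : Tendsto β L (𝓝 b)) {c : ℝ≥0∞}
    (hc : c < ∫⁻ u, nlog m (ip b u) ∂(R : Measure (Fin m → ℝ))) :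
    ∀ᶠ n in L, c < ∫⁻ u, nlog m (ip (β n) u) ∂(P n : Measure (Fin m → ℝ)) := by
  let ε : ℕ → ℝ := fun k => 1 / ((k : ℝ) + 1)
  have hεpos : ∀ k, 0 < ε k := fun k => Nat.one_div_pos_of_nat
  have hε : Tendsto ε atTop (𝓝 0) := tendsto_one_div_add_atTop_nhds_zero_nat
  have hmeas : ∀ k, Measurable fun u => nlog m (max (ip b u + m * ε k) (ε k)) := fun k =>
    ((nlog_continuous m).comp (((continuous_ip_right b).add continuous_const).max
      continuous_const)).measurable
  have hpt : ∀ u, nlog m (ip b u) ≤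
      liminf (fun k => nlog m (max (ip b u + m * ε k) (ε k))) atTop := by
    intro u
    have h1 : Tendsto (fun k => max (ip b u + m * ε k) (ε k)) atTop
        (𝓝 (max (ip b u + m * 0) 0)) := ((hε.const_mul _).const_add _).max hε
    have h2 : Tendsto (fun k => nlog m (max (ip b u + m * ε k) (ε k))) atTop _ :=
      ((nlog_continuous m).tendsto _).comp h1
    rw [h2.liminf_eq, mul_zero, add_zero]
    rcases le_or_gt (ip b u) 0 with hu | hu
    · rw [max_eq_right hu, nlog_of_nonpos le_rfl]
      exact le_top
    · rw [max_eq_left hu.le]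
  have hfatou := hc.trans_le ((lintegral_mono hpt).trans (lintegral_liminf_le hmeas))
  obtain ⟨k, hk⟩ := (eventually_lt_of_lt_liminf hfatou).exists
  have hclose : ∀ᶠ n in L, ∀ i, β n i ≤ b i + ε k := by
    rw [eventually_all]
    intro i
    filter_upwards [(tendsto_pi_nhds.mp hβ i).eventually
      (gt_mem_nhds (lt_add_of_pos_right (b i) (hεpos k)))] with n hn using hn.le
  filter_upwards [hclose, (tendsto_lintegral_nlog_max h
    ((continuous_ip_right b).add continuous_const) (hεpos k)).eventually (lt_mem_nhds hk)]
    with n hn hlt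
  refine hlt.trans_le (lintegral_mono_ae ?_)
  filter_upwards [ae_mem_Kset (hP n)] with u hu
  refine nlog_antitone m (le_max_of_le_left ?_)
  calc ip (β n) u ≤ ∑ i, (b i + ε k) * u i :=
        Finset.sum_le_sum fun i _ => mul_le_mul_of_nonneg_right (hn i) (hu.1 i)
    _ = ip b u + m * ε k := by
        simp only [add_mul, Finset.sum_add_distrib, ← Finset.mul_sum, sum_eq_of_mem_Kset hm hu, ip]
        ring

lemma lintegral_nlog_bhat_ne_top {R : ProbabilityMeasure (Fin m → ℝ)}
    (hR : (R : Measure (Fin m → ℝ)) (Kset m) = 1) :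
    ∫⁻ u, nlog m (ip (bhat m) u) ∂(R : Measure (Fin m → ℝ)) ≠ ⊤ := by
  have h : ∫⁻ u, nlog m (ip (bhat m) u) ∂(R : Measure (Fin m → ℝ)) =
      ∫⁻ _, nlog m 1 ∂(R : Measure (Fin m → ℝ)) := by
    refine lintegral_congr_ae ?_
    filter_upwards [ae_mem_Kset hR] with u hu
    rw [hu.2]
  rw [h, lintegral_const, measure_univ, mul_one, nlog_of_pos one_pos]
  exact ENNReal.ofReal_ne_top

/-- The optimal returns are almost surely unique. -/
lemma ae_ip_eq_of_minimizers (hm : m ≠ 0) {R : ProbabilityMeasure (Fin m → ℝ)}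
    (hR : (R : Measure (Fin m → ℝ)) (Kset m) = 1) {b b' : Fin m → ℝ}
    (hb : b ∈ simplex m) (hb' : b' ∈ simplex m)
    (hmin : ∀ a ∈ simplex m, ∫⁻ u, nlog m (ip b u) ∂(R : Measure (Fin m → ℝ)) ≤
      ∫⁻ u, nlog m (ip a u) ∂(R : Measure (Fin m → ℝ)))
    (hle : ∫⁻ u, nlog m (ip b' u) ∂(R : Measure (Fin m → ℝ)) ≤
      ∫⁻ u, nlog m (ip b u) ∂(R : Measure (Fin m → ℝ))) :
    ∀ᵐ u ∂(R : Measure (Fin m → ℝ)), ip b' u = ip b u := by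
  set μ := (R : Measure (Fin m → ℝ))
  have hfin : ∫⁻ u, nlog m (ip b u) ∂μ ≠ ⊤ :=
    ne_top_of_le_ne_top (lintegral_nlog_bhat_ne_top hR) (hmin _ (bhat_mem_simplex hm))
  have hfin' : ∫⁻ u, nlog m (ip b' u) ∂μ ≠ ⊤ := ne_top_of_le_ne_top hfin hle
  set a := (1 / 2 : ℝ) • b' + (1 / 2 : ℝ) • b with ha
  have has : a ∈ simplex m := convex_simplex m hb' hb (by norm_num) (by norm_num) (by norm_num)
  have hip : ∀ u, ip a u = (ip b' u + ip b u) / 2 := by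
    intro u
    rw [ha, ip_add_left, ip_smul_left, ip_smul_left]
    ring
  have hpt : ∀ᵐ u ∂μ, 2 * nlog m (ip a u) ≤ nlog m (ip b' u) + nlog m (ip b u) := by
    filter_upwards [ae_mem_Kset hR] with u hu
    rw [hip]
    exact two_nlog_midpoint_le (ip_le hm hb' hu) (ip_le hm hb hu)
  have hsum : ∫⁻ u, (nlog m (ip b' u) + nlog m (ip b u)) ∂μ =
      ∫⁻ u, nlog m (ip b' u) ∂μ + ∫⁻ u, nlog m (ip b u) ∂μ :=
    lintegral_add_left (measurable_nlog_ip b') _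
  have heq := ae_eq_of_ae_le_of_lintegral_le hpt
    (ne_top_of_le_ne_top (hsum ▸ ENNReal.add_ne_top.mpr ⟨hfin', hfin⟩) (lintegral_mono_ae hpt))
    ((measurable_nlog_ip b').add (measurable_nlog_ip b)).aemeasurable (by
      rw [hsum, lintegral_const_mul _ (measurable_nlog_ip a), two_mul]
      exact add_le_add (hle.trans (hmin a has)) (hmin a has))
  filter_upwards [heq, ae_mem_Kset hR, ae_lt_top (measurable_nlog_ip b) hfin,
    ae_lt_top (measurable_nlog_ip b') hfin'] with u h1 hu h2 h3
  rw [hip] at h1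
  exact eq_of_two_nlog_midpoint (ip_le hm hb' hu) (ip_le hm hb hu) h3.ne h2.ne h1

/-- Larger expected log-return means smaller expected logarithmic loss. -/
lemma lintegral_nlog_le_of_elogQ_le {μ : Measure (Fin m → ℝ)} {a b : Fin m → ℝ}
    (h : elogQ μ a ≤ elogQ μ b) :
    ∫⁻ u, nlog m (ip b u) ∂μ ≤ ∫⁻ u, nlog m (ip a u) ∂μ := by
  by_contra! hlt
  refine absurd h (not_le.mpr ?_)
  exact EReal.sub_lt_sub_of_le_of_gt le_rfl (EReal.coe_ennreal_lt_coe_ennreal_iff.mpr hlt)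
    (EReal.coe_ne_top _) (EReal.coe_ne_bot _)

lemma continuous_coe_sub_ennreal (a : ℝ) :
    Continuous fun x : ℝ≥0∞ => (a : EReal) - (x : EReal) := by
  rw [continuous_iff_continuousAt]
  intro x
  have h := EReal.continuousAt_add (p := ((a : EReal), -(x : EReal)))
    (Or.inl (EReal.coe_ne_top a)) (Or.inl (EReal.coe_ne_bot a))
  exact h.comp (f := fun x : ℝ≥0∞ => ((a : EReal), -(x : EReal)))
    (continuousAt_const.prodMk (continuous_neg.comp continuous_coe_ennreal_ereal).continuousAt)

end Optimal

/-- Lemma 4(b): under weak convergence `Q_n → Q_∞` of probability measures on `K`,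
the optimal values `V(Q_n)` converge to `V(Q_∞)`, and the optimal returns
`⟨b*(Q_n), u⟩` converge to `⟨b*(Q_∞), u⟩` for `Q_∞`-almost every `u`. -/
theorem stmt_8 (m : ℕ) (hm : 2 ≤ m)
    (Q : ℕ → ProbabilityMeasure (Fin m → ℝ)) (Qinf : ProbabilityMeasure (Fin m → ℝ))
    (hsupp : ∀ n, (Q n : Measure (Fin m → ℝ)) (Kset m) = 1)
    (hsuppinf : (Qinf : Measure (Fin m → ℝ)) (Kset m) = 1)
    (hconv : Tendsto Q atTop (𝓝 Qinf))
    (bstar : ℕ → (Fin m → ℝ)) (hbstar : ∀ n, bstar n ∈ simplex m)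
    (hmax : ∀ n, ∀ b ∈ simplex m,
      elogQ (Q n : Measure (Fin m → ℝ)) b ≤ elogQ (Q n : Measure (Fin m → ℝ)) (bstar n))
    (binf : Fin m → ℝ) (hbinf : binf ∈ simplex m)
    (hmaxinf : ∀ b ∈ simplex m,
      elogQ (Qinf : Measure (Fin m → ℝ)) b ≤ elogQ (Qinf : Measure (Fin m → ℝ)) binf) :
    Tendsto (fun n => ⨆ b ∈ simplex m, elogQ (Q n : Measure (Fin m → ℝ)) b) atTop
        (𝓝 (⨆ b ∈ simplex m, elogQ (Qinf : Measure (Fin m → ℝ)) b))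
    ∧ ∀ᵐ u ∂(Qinf : Measure (Fin m → ℝ)),
        Tendsto (fun n => ip (bstar n) u) atTop (𝓝 (ip binf u)) := by
  have hm0 : m ≠ 0 := by omega
  have hmin n b (hb : b ∈ simplex m) := lintegral_nlog_le_of_elogQ_le (hmax n b hb)
  have hmininf b (hb : b ∈ simplex m) := lintegral_nlog_le_of_elogQ_le (hmaxinf b hb)
  -- Along an ultrafilter the maximizers converge, and the limit is again a maximizer.
  have cluster : ∀ g : Ultrafilter ℕ, (g : Filter ℕ) ≤ atTop → ∃ b ∈ simplex m,
      Tendsto bstar g (𝓝 b) ∧ ∫⁻ u, nlog m (ip b u) ∂(Qinf : Measure (Fin m → ℝ)) ≤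
        ∫⁻ u, nlog m (ip binf u) ∂(Qinf : Measure (Fin m → ℝ)) := by
    intro g hg
    obtain ⟨b, hb, hlim⟩ := (isCompact_simplex m).ultrafilter_le_nhds' (g.map bstar)
      (Ultrafilter.mem_map.mpr (univ_mem' hbstar))
    have hlim' : Tendsto bstar g (𝓝 b) := hlim
    refine ⟨b, hb, hlim', ?_⟩
    by_contra! hlt
    obtain ⟨c, hc1, hc2⟩ := exists_between hlt
    obtain ⟨n, hn1, hn2⟩ := ((eventually_lintegral_nlog_lt hm0 hsupp hsuppinf
      (hconv.mono_left hg) hmin hbinf hc1).and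
      (eventually_lt_lintegral_nlog hm0 hsupp (hconv.mono_left hg) hlim' hc2)).exists
    exact lt_asymm hn1 hn2
  constructor
  · have hsup n : ⨆ b ∈ simplex m, elogQ (Q n : Measure (Fin m → ℝ)) b =
        elogQ (Q n : Measure (Fin m → ℝ)) (bstar n) :=
      le_antisymm (iSup₂_le (hmax n)) (le_iSup₂_of_le _ (hbstar n) le_rfl)
    have hsupinf : ⨆ b ∈ simplex m, elogQ (Qinf : Measure (Fin m → ℝ)) b =
        elogQ (Qinf : Measure (Fin m → ℝ)) binf :=
      le_antisymm (iSup₂_le hmaxinf) (le_iSup₂_of_le _ hbinf le_rfl)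
    simp only [hsup, hsupinf]
    refine ((continuous_coe_sub_ennreal (Real.log m)).tendsto _).comp ?_
    rw [tendsto_iff_ultrafilter]
    intro g hg
    obtain ⟨b, hb, hlim, -⟩ := cluster g hg
    exact tendsto_order.mpr
      ⟨fun c hc => eventually_lt_lintegral_nlog hm0 hsupp (hconv.mono_left hg) hlim
        (hc.trans_le (hmininf b hb)),
      fun c hc => eventually_lintegral_nlog_lt hm0 hsupp hsuppinf (hconv.mono_left hg) hmin
        hbinf hc⟩
  · filter_upwards [ae_forall_ip_eq_zero (Qinf : Measure (Fin m → ℝ))] with u hu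
    rw [tendsto_iff_ultrafilter]
    intro g hg
    obtain ⟨b, hb, hlim, hle⟩ := cluster g hg
    have hdiff v : ip (b + (-1 : ℝ) • binf) v = ip b v - ip binf v := by
      rw [ip_add_left, ip_smul_left]
      ring
    have hzero : ip (b + (-1 : ℝ) • binf) u = 0 := by
      refine hu _ ?_
      filter_upwards [ae_ip_eq_of_minimizers hm0 hsuppinf hbinf hb hmininf hle] with v hv
      rw [hdiff, hv, sub_self]
    rw [hdiff, sub_eq_zero] at hzero
    rw [← hzero]
    exact ((continuous_ip_left u).tendsto b).comp hlim
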